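/- Let λ > 0, p > 0, q > 0, τ ∈ ℝ, −1 ≤ δ < p−1, let a ∈ A^τ_δ(ℝ), let χ ∈ S(ℝ) with χ(0) = 1, let 0 < ε < 1, set χ_ε(x) := χ(εx) with k-th derivative χ_ε^{(k)}, and fix an integer k ≥ 0. Then: (a) if q > p, for every integer l with 1 ≤ l ≤ [q/p), ∫₀^∞ e^{±iλx^p} x^{q−1} a(x) χ_ε^{(k)}(x) dx = ∫₀^∞ e^{±iλx^p} (±L*)^l (x^{q−1} a(x) χ_ε^{(k)}(x)) dx; (b) for arbitrary p > 0 and q > 0, if ψ := 1 − φ for a cut-off function φ, then for every integer l ≥ 1, ∫₀^∞ e^{±iλx^p} x^{q−1} a(x) ψ(x) χ_ε^{(k)}(x) dx = ∫₀^∞ e^{±iλx^p} (±L*)^l (x^{q−1} a(x) ψ(x) χ_ε^{(k)}(x)) dx, where all integrals are absolutely convergent and the double signs are taken in the same order. -/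

import Mathlib

open MeasureTheory Filter Topology Set

/-- The amplitude class `A^τ_δ(ℝ)`. -/
def AmpClass (τ δ : ℝ) (a : ℝ → ℂ) : Prop :=
  ContDiff ℝ (⊤ : ℕ∞) a ∧ ∀ k : ℕ, ∃ C : ℝ, 0 < C ∧ ∀ x : ℝ,
    ‖iteratedDeriv k a x‖ ≤ C * (1 + x ^ 2) ^ ((τ + δ * k) / 2)

/-- A cut-off function. -/
def IsCutoff (φ : ℝ → ℂ) : Prop :=
  ContDiff ℝ (⊤ : ℕ∞) φ ∧ ∃ r₀ r₁ : ℝ, 1 ≤ r₀ ∧ r₀ < r₁ ∧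
    (∀ x : ℝ, |x| ≤ r₀ → φ x = 1) ∧ ∀ x : ℝ, r₁ ≤ |x| → φ x = 0

/-- The formal adjoint operator `L* g (x) = -(1/(iλ)) d/dx [ g(x) / (p x^{p-1}) ]`. -/
noncomputable def Lstar (lam p : ℝ) (g : ℝ → ℂ) : ℝ → ℂ :=
  fun x => -(1 / (Complex.I * lam)) * deriv (fun y => g y / ((p * y ^ (p - 1) : ℝ) : ℂ)) x

/-- Functions in the amplitude class have temperate growth. -/
theorem AmpClass.hasTemperateGrowth {τ δ : ℝ} {a : ℝ → ℂ} (ha : AmpClass τ δ a) :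
    a.HasTemperateGrowth := by
  refine ⟨ha.1, fun n => ?_⟩
  obtain ⟨C, hC, h⟩ := ha.2 n
  set e : ℝ := (τ + δ * n) / 2
  refine ⟨2 * ⌈e⌉₊, C, fun x => ?_⟩
  rw [norm_iteratedFDeriv_eq_norm_iteratedDeriv]
  refine (h x).trans (mul_le_mul_of_nonneg_left ?_ hC.le)
  calc (1 + x ^ 2) ^ e ≤ (1 + x ^ 2) ^ (⌈e⌉₊ : ℝ) :=
        Real.rpow_le_rpow_of_exponent_le (by nlinarith [sq_nonneg x]) (Nat.le_ceil e)
    _ = (1 + x ^ 2) ^ ⌈e⌉₊ := Real.rpow_natCast _ _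
    _ ≤ ((1 + ‖x‖) ^ 2) ^ ⌈e⌉₊ := by
        gcongr
        rw [Real.norm_eq_abs]
        nlinarith [abs_nonneg x, sq_abs x]
    _ = (1 + ‖x‖) ^ (2 * ⌈e⌉₊) := (pow_mul _ _ _).symm

/-- A cut-off function vanishes outside a compact set, hence has temperate growth. -/
theorem IsCutoff.hasTemperateGrowth {φ : ℝ → ℂ} (hφ : IsCutoff φ) : φ.HasTemperateGrowth := by
  obtain ⟨hs, r₀, r₁, -, -, -, h⟩ := hφ
  refine HasCompactSupport.hasTemperateGrowth ?_ hs
  refine HasCompactSupport.intro (isCompact_Icc (a := -r₁) (b := r₁)) fun x hx => h x ?_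
  by_contra! hlt
  exact hx ⟨(abs_lt.1 hlt).1.le, (abs_lt.1 hlt).2.le⟩

/-- Iterated derivatives of dilated Schwartz functions are Schwartz. -/
theorem exists_schwartzMap_iteratedDeriv_comp_mul (χ : SchwartzMap ℝ ℂ) {ε : ℝ} (hε : ε ≠ 0)
    (k : ℕ) : ∃ h : SchwartzMap ℝ ℂ, ∀ x, h x = iteratedDeriv k (fun z => χ (ε * z)) x := by
  induction k with
  | zero =>
    refine ⟨SchwartzMap.compCLMOfContinuousLinearEquiv ℂ
      (ContinuousLinearEquiv.unitsEquivAut ℝ (Units.mk0 ε hε)) χ, fun x => ?_⟩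
    simp [mul_comm]
  | succ k ih =>
    obtain ⟨h, hh⟩ := ih
    refine ⟨SchwartzMap.derivCLM ℂ ℂ h, fun x => ?_⟩
    rw [iteratedDeriv_succ, SchwartzMap.derivCLM_apply, funext hh]

/-- The Schwartz function `σ h + x h'`, so that `(x ^ σ h)' = x ^ (σ - 1) (σ h + x h')`. -/
noncomputable def shiftedEuler (σ : ℝ) (h : SchwartzMap ℝ ℂ) : SchwartzMap ℝ ℂ :=
  (σ : ℂ) • h + SchwartzMap.smulLeftCLM ℂ Complex.ofReal (SchwartzMap.derivCLM ℂ ℂ h)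

theorem shiftedEuler_apply (σ : ℝ) (h : SchwartzMap ℝ ℂ) (x : ℝ) :
    shiftedEuler σ h x = σ * h x + x * deriv h x := by
  simp [shiftedEuler, SchwartzMap.smulLeftCLM_apply_apply Function.Complex.hasTemperateGrowth_ofReal]

theorem shiftedEuler_eventuallyEq_zero {h : SchwartzMap ℝ ℂ} (σ : ℝ) (hh : h =ᶠ[𝓝 0] 0) :
    shiftedEuler σ h =ᶠ[𝓝 0] 0 := by
  filter_upwards [hh, hh.deriv] with x hx hx'
  have : deriv (0 : ℝ → ℂ) x = 0 := by simp
  simp [shiftedEuler_apply, hx, hx', this]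

theorem hasDerivAt_rpow_mul_schwartzMap (σ : ℝ) (h : SchwartzMap ℝ ℂ) {x : ℝ} (hx : 0 < x) :
    HasDerivAt (fun y : ℝ => ((y ^ σ : ℝ) : ℂ) * h y)
      (((x ^ (σ - 1) : ℝ) : ℂ) * shiftedEuler σ h x) x := by
  have hpow : x ^ σ = x ^ (σ - 1) * x := by
    rw [← Real.rpow_add_one hx.ne', sub_add_cancel]
  refine ((Real.hasDerivAt_rpow_const (p := σ) (Or.inl hx.ne')).ofReal_comp.mul
    (h.hasDerivAt x)).congr_deriv ?_
  rw [shiftedEuler_apply, hpow]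
  push_cast
  ring

theorem integrableOn_rpow_mul_schwartzMap {r : ℝ} (h : SchwartzMap ℝ ℂ)
    (hr : -1 < r ∨ h =ᶠ[𝓝 0] 0) :
    IntegrableOn (fun x : ℝ => ((x ^ r : ℝ) : ℂ) * h x) (Ioi 0) := by
  have key : MellinConvergent h ((r + 1 : ℝ) : ℂ) := by
    obtain ⟨b, hb, hO⟩ : ∃ b : ℝ, b < r + 1 ∧ h =O[𝓝[>] 0] (fun x : ℝ => x ^ (-b)) := by
      rcases hr with hr | hr
      · refine ⟨0, by linarith, ?_⟩
        simpa using (h.continuous.tendsto 0).isBigO_one ℝ |>.mono nhdsWithin_le_nhds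
      · refine ⟨r, by linarith, ?_⟩
        exact (hr.filter_mono nhdsWithin_le_nhds).trans_isBigO (Asymptotics.isBigO_zero _ _)
    refine mellinConvergent_of_isBigO_rpow (a := r + 2) (b := b)
      (h.continuous.locallyIntegrable.locallyIntegrableOn _) ?_ ?_ hO ?_
    · refine ((h.isBigO_cocompact_rpow (-(r + 2))).mono atTop_le_cocompact).congr' .rfl ?_
      filter_upwards [eventually_ge_atTop 0] with x hx
      rw [Real.norm_of_nonneg hx]
    · rw [Complex.ofReal_re]; linarith
    · rwa [Complex.ofReal_re]
  refine IntegrableOn.congr_fun key (fun x hx => ?_) measurableSet_Ioi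
  simp [Complex.ofReal_cpow (le_of_lt hx)]

theorem tendsto_rpow_mul_schwartzMap_nhdsGT_zero {σ : ℝ} (h : SchwartzMap ℝ ℂ)
    (hσ : 0 < σ ∨ h =ᶠ[𝓝 0] 0) :
    Tendsto (fun x : ℝ => ((x ^ σ : ℝ) : ℂ) * h x) (𝓝[>] 0) (𝓝 0) := by
  rcases hσ with hσ | hσ
  · have h₁ : Tendsto (fun x : ℝ => ((x ^ σ : ℝ) : ℂ)) (𝓝 0) (𝓝 0) := by
      have := (Real.continuousAt_rpow_const 0 σ (Or.inr hσ.le)).tendsto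
      rw [Real.zero_rpow hσ.ne'] at this
      exact_mod_cast (Complex.continuous_ofReal.tendsto 0).comp this
    simpa using (h₁.mul (h.continuous.tendsto 0)).mono_left nhdsWithin_le_nhds
  · refine tendsto_const_nhds.congr' ?_
    filter_upwards [hσ.filter_mono nhdsWithin_le_nhds] with x hx
    simp [hx]

theorem tendsto_rpow_mul_schwartzMap_atTop (σ : ℝ) (h : SchwartzMap ℝ ℂ) :
    Tendsto (fun x : ℝ => ((x ^ σ : ℝ) : ℂ) * h x) atTop (𝓝 0) := by
  have hO : (fun x : ℝ => ((x ^ σ : ℝ) : ℂ) * h x) =O[atTop] (fun x : ℝ => x ^ (-1 : ℝ)) := by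
    have h₁ : (fun x : ℝ => ((x ^ σ : ℝ) : ℂ)) =O[atTop] (fun x : ℝ => x ^ σ) :=
      Asymptotics.isBigO_of_le _ fun x => by simp
    refine (h₁.mul ((h.isBigO_cocompact_rpow (-1 - σ)).mono atTop_le_cocompact)).congr' .rfl ?_
    filter_upwards [eventually_gt_atTop 0] with x hx
    rw [Real.norm_of_nonneg hx.le, ← Real.rpow_add hx]
    congr 1
    ring
  exact hO.trans_tendsto (tendsto_rpow_neg_atTop one_pos)

/-- The phase `exp (i s λ x ^ p)` has modulus one. -/
theorem norm_exp_I_mul_rpow (s lam p x : ℝ) :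
    ‖Complex.exp (s * Complex.I * lam * ((x ^ p : ℝ) : ℂ))‖ = 1 := by
  rw [show (s * Complex.I * lam * ((x ^ p : ℝ) : ℂ)) = ((s * lam * x ^ p : ℝ) : ℂ) * Complex.I by
    push_cast; ring]
  exact Complex.norm_exp_ofReal_mul_I _

theorem hasDerivAt_exp_I_mul_rpow (s lam p : ℝ) {x : ℝ} (hx : 0 < x) :
    HasDerivAt (fun y : ℝ => Complex.exp (s * Complex.I * lam * ((y ^ p : ℝ) : ℂ)))
      (Complex.exp (s * Complex.I * lam * ((x ^ p : ℝ) : ℂ)) *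
        (s * Complex.I * lam * ((p * x ^ (p - 1) : ℝ) : ℂ))) x :=
  (((Real.hasDerivAt_rpow_const (p := p) (Or.inl hx.ne')).ofReal_comp).const_mul _).cexp

theorem integrableOn_exp_I_mul_rpow_mul {g : ℝ → ℂ} (hg : IntegrableOn g (Ioi 0))
    (s lam p : ℝ) :
    IntegrableOn (fun x : ℝ => Complex.exp (s * Complex.I * lam * ((x ^ p : ℝ) : ℂ)) * g x)
      (Ioi 0) := by
  refine Integrable.bdd_mul (c := 1) hg ?_ ?_
  · refine ContinuousOn.aestronglyMeasurable (fun x hx => ?_) measurableSet_Ioi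
    exact (hasDerivAt_exp_I_mul_rpow s lam p hx).continuousAt.continuousWithinAt
  · exact Eventually.of_forall fun x => (norm_exp_I_mul_rpow s lam p x).le

/-- `L*` maps `x ^ r h` to a multiple of `x ^ (r - p) ((r - p + 1) h + x h')`. -/
theorem eqOn_Lstar {lam p r : ℝ} (hp : p ≠ 0) {g : ℝ → ℂ} {h : SchwartzMap ℝ ℂ}
    (hg : EqOn g (fun x : ℝ => ((x ^ r : ℝ) : ℂ) * h x) (Ioi 0)) :
    EqOn (Lstar lam p g) (fun x : ℝ => -(1 / (Complex.I * lam * p)) *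
      (((x ^ (r - p) : ℝ) : ℂ) * shiftedEuler (r - p + 1) h x)) (Ioi 0) := by
  intro x hx
  have hev : (fun y => g y / ((p * y ^ (p - 1) : ℝ) : ℂ)) =ᶠ[𝓝 x]
      fun y => (1 / (p : ℂ)) * (((y ^ (r - p + 1) : ℝ) : ℂ) * h y) := by
    filter_upwards [Ioi_mem_nhds hx] with y hy
    have hpC : (p : ℂ) ≠ 0 := by exact_mod_cast hp
    have hy' : ((y ^ (p - 1) : ℝ) : ℂ) ≠ 0 := by
      exact_mod_cast (Real.rpow_pos_of_pos hy _).ne'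
    have hpow : y ^ r = y ^ (r - p + 1) * y ^ (p - 1) := by
      rw [← Real.rpow_add hy]; congr 1; ring
    simp only [hg hy, hpow]
    push_cast
    field_simp
  have hd := (hasDerivAt_rpow_mul_schwartzMap (r - p + 1) h hx).const_mul (1 / (p : ℂ))
  simp only [Lstar]
  rw [hev.deriv_eq, hd.deriv, show r - p + 1 - 1 = r - p by ring]
  rw [← mul_assoc, neg_mul, one_div_mul_one_div]

/-- A single integration by parts against the phase. -/
theorem integral_exp_mul_Lstar {lam p r s : ℝ} (hlam : 0 < lam) (hp : 0 < p)
    (hs : s = 1 ∨ s = -1) {g : ℝ → ℂ} {h : SchwartzMap ℝ ℂ}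
    (hg : EqOn g (fun x : ℝ => ((x ^ r : ℝ) : ℂ) * h x) (Ioi 0))
    (hr : p < r + 1 ∨ h =ᶠ[𝓝 0] 0) :
    (∫ x in Ioi (0 : ℝ), Complex.exp (s * Complex.I * lam * ((x ^ p : ℝ) : ℂ)) * g x) =
      ∫ x in Ioi (0 : ℝ), Complex.exp (s * Complex.I * lam * ((x ^ p : ℝ) : ℂ)) *
        ((s : ℂ) * Lstar lam p g x) := by
  set E : ℝ → ℂ := fun x => Complex.exp (s * Complex.I * lam * ((x ^ p : ℝ) : ℂ)) with hE
  set c : ℂ := s * Complex.I * lam * p with hc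
  set h₁ := shiftedEuler (r - p + 1) h with hh₁
  have hs2 : (s : ℂ) * s = 1 := by rcases hs with rfl | rfl <;> simp
  have hI := integrableOn_rpow_mul_schwartzMap h (hr.imp_left fun hr => by linarith : -1 < r ∨ _)
  have hI₁ := integrableOn_rpow_mul_schwartzMap (r := r - p) h₁
    (hr.imp (fun hr => by linarith) (shiftedEuler_eventuallyEq_zero _))
  have hder : ∀ x ∈ Ioi (0 : ℝ), E x * (s * Complex.I * lam * ((p * x ^ (p - 1) : ℝ) : ℂ)) *
      (((x ^ (r - p + 1) : ℝ) : ℂ) * h x) = c * (E x * g x) := by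
    intro x hx
    have hpow : x ^ r = x ^ (p - 1) * x ^ (r - p + 1) := by
      rw [← Real.rpow_add hx]; congr 1; ring
    rw [hg hx]
    simp only [hpow, hc]
    push_cast
    ring
  have hEg : IntegrableOn (fun x => E x * g x) (Ioi 0) :=
    (integrableOn_exp_I_mul_rpow_mul hI s lam p).congr_fun
      (fun x hx => by simp only [hE, hg hx]) measurableSet_Ioi
  have hbdd : ∀ {l : Filter ℝ}, Tendsto (fun x : ℝ => ((x ^ (r - p + 1) : ℝ) : ℂ) * h x) l (𝓝 0) →
      Tendsto (E * fun x : ℝ => ((x ^ (r - p + 1) : ℝ) : ℂ) * h x) l (𝓝 0) := fun ht =>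
    squeeze_zero_norm (fun x => by simp [hE, norm_exp_I_mul_rpow])
      (tendsto_zero_iff_norm_tendsto_zero.1 ht)
  have hparts := integral_Ioi_mul_deriv_eq_deriv_mul (a := 0) (a' := 0) (b' := 0) (u := E)
    (v := fun x : ℝ => ((x ^ (r - p + 1) : ℝ) : ℂ) * h x)
    (v' := fun x : ℝ => ((x ^ (r - p) : ℝ) : ℂ) * h₁ x)
    (fun x hx => hasDerivAt_exp_I_mul_rpow s lam p hx)
    (fun x hx => by
      have := hasDerivAt_rpow_mul_schwartzMap (r - p + 1) h hx
      rwa [add_sub_cancel_right] at this)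
    (integrableOn_exp_I_mul_rpow_mul hI₁ s lam p)
    (IntegrableOn.congr_fun (hEg.const_mul c) (fun x hx => (hder x hx).symm) measurableSet_Ioi)
    (hbdd (tendsto_rpow_mul_schwartzMap_nhdsGT_zero h (hr.imp_left fun hr => by linarith)))
    (hbdd (tendsto_rpow_mul_schwartzMap_atTop _ h))
  rw [setIntegral_congr_fun measurableSet_Ioi hder, integral_const_mul] at hparts
  have hL := eqOn_Lstar (lam := lam) hp.ne' hg
  have hR : ∀ x ∈ Ioi (0 : ℝ), E x * ((s : ℂ) * Lstar lam p g x) =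
      -(s / (Complex.I * lam * p)) * (E x * (((x ^ (r - p) : ℝ) : ℂ) * h₁ x)) := by
    intro x hx
    rw [hL hx]
    ring
  rw [setIntegral_congr_fun measurableSet_Ioi hR, integral_const_mul, hparts]
  have hlamC : (lam : ℂ) ≠ 0 := by exact_mod_cast hlam.ne'
  have hpC : (p : ℂ) ≠ 0 := by exact_mod_cast hp.ne'
  have hone : s / (Complex.I * lam * p) * c = 1 := by
    rw [hc]
    field_simp [Complex.I_ne_zero]
    rw [sq, hs2]
  linear_combination (-∫ x in Ioi (0 : ℝ), E x * g x) * hone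

/-- Iterated integration by parts for `x ^ r h` with `h` Schwartz, provided that the powers stay
integrable at the origin or that `h` vanishes near the origin. -/
theorem integral_exp_mul_iterate_Lstar {lam p s : ℝ} (hlam : 0 < lam) (hp : 0 < p)
    (hs : s = 1 ∨ s = -1) (l : ℕ) {r : ℝ} {g : ℝ → ℂ} {h : SchwartzMap ℝ ℂ}
    (hg : EqOn g (fun x : ℝ => ((x ^ r : ℝ) : ℂ) * h x) (Ioi 0))
    (hr : l * p < r + 1 ∨ h =ᶠ[𝓝 0] 0) :
    IntegrableOn (fun x : ℝ => Complex.exp (s * Complex.I * lam * ((x ^ p : ℝ) : ℂ)) *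
        (fun g => fun y => (s : ℂ) * Lstar lam p g y)^[l] g x) (Ioi 0) ∧
      (∫ x in Ioi (0 : ℝ), Complex.exp (s * Complex.I * lam * ((x ^ p : ℝ) : ℂ)) * g x) =
        ∫ x in Ioi (0 : ℝ), Complex.exp (s * Complex.I * lam * ((x ^ p : ℝ) : ℂ)) *
          (fun g => fun y => (s : ℂ) * Lstar lam p g y)^[l] g x := by
  induction l generalizing r g h with
  | zero =>
    refine ⟨?_, rfl⟩
    have hI := integrableOn_rpow_mul_schwartzMap (r := r) h
      (hr.imp_left fun hr => by simp at hr; linarith)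
    exact (integrableOn_exp_I_mul_rpow_mul hI s lam p).congr_fun
      (fun x hx => by simp only [hg hx, Function.iterate_zero, id]) measurableSet_Ioi
  | succ l ih =>
    have hg' : EqOn (fun y => (s : ℂ) * Lstar lam p g y) (fun x : ℝ => ((x ^ (r - p) : ℝ) : ℂ) *
        (-(s / (Complex.I * lam * p)) • shiftedEuler (r - p + 1) h) x) (Ioi 0) := by
      intro x hx
      simp only [eqOn_Lstar (lam := lam) hp.ne' hg hx, smul_apply, smul_eq_mul]
      ring
    have hr' : l * p < r - p + 1 ∨
        (-(s / (Complex.I * lam * p)) • shiftedEuler (r - p + 1) h : SchwartzMap ℝ ℂ)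
          =ᶠ[𝓝 0] 0 := by
      refine hr.imp (fun hr => by push_cast at hr; linarith) fun hr => ?_
      filter_upwards [shiftedEuler_eventuallyEq_zero (r - p + 1) hr] with x hx
      simp [hx]
    have hstep := integral_exp_mul_Lstar hlam hp hs hg
      (hr.imp_left fun hr => by
        push_cast at hr
        nlinarith [mul_nonneg (Nat.cast_nonneg (α := ℝ) l) hp.le])
    obtain ⟨hint, heq⟩ := ih hg' hr'
    simp only [Function.iterate_succ_apply]
    exact ⟨hint, hstep.trans heq⟩

/-- **Integration by parts via the iterated formal adjoint** (double signs in the same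
order, encoded by `s = ±1`): (a) for `q > p` and `1 ≤ l ≤ [q/p) = ⌈q/p⌉ - 1`, and
(b) for arbitrary `p, q > 0`, `ψ = 1 - φ` and every `l ≥ 1`,
`∫₀^∞ e^{±iλx^p} (integrand) dx = ∫₀^∞ e^{±iλx^p} (±L*)^l (integrand) dx`,
all integrals being absolutely convergent. -/
theorem Lstar_integration_by_parts (lam p q τ δ : ℝ) (hlam : 0 < lam) (hp : 0 < p)
    (hq : 0 < q) (hδ₁ : -1 ≤ δ) (hδ₂ : δ < p - 1) (a : ℝ → ℂ) (ha : AmpClass τ δ a)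
    (χ : SchwartzMap ℝ ℂ) (hχ : χ 0 = 1) (ε : ℝ) (hε₀ : 0 < ε) (hε₁ : ε < 1) (k : ℕ)
    (s : ℝ) (hs : s = 1 ∨ s = -1) :
    (p < q → ∀ l : ℕ, 1 ≤ l → (l : ℤ) ≤ ⌈q / p⌉ - 1 →
      IntegrableOn
        (fun x : ℝ => Complex.exp (s * Complex.I * lam * ((x ^ p : ℝ) : ℂ)) *
          (((x ^ (q - 1) : ℝ) : ℂ) * a x * iteratedDeriv k (fun z => χ (ε * z)) x))
        (Set.Ioi 0) ∧
      IntegrableOn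
        (fun x : ℝ => Complex.exp (s * Complex.I * lam * ((x ^ p : ℝ) : ℂ)) *
          (fun g => fun y => (s : ℂ) * Lstar lam p g y)^[l]
            (fun y => ((y ^ (q - 1) : ℝ) : ℂ) * a y *
              iteratedDeriv k (fun z => χ (ε * z)) y) x)
        (Set.Ioi 0) ∧
      (∫ x in Set.Ioi (0 : ℝ),
          Complex.exp (s * Complex.I * lam * ((x ^ p : ℝ) : ℂ)) *
            (((x ^ (q - 1) : ℝ) : ℂ) * a x * iteratedDeriv k (fun z => χ (ε * z)) x)) =
        ∫ x in Set.Ioi (0 : ℝ),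
          Complex.exp (s * Complex.I * lam * ((x ^ p : ℝ) : ℂ)) *
            (fun g => fun y => (s : ℂ) * Lstar lam p g y)^[l]
              (fun y => ((y ^ (q - 1) : ℝ) : ℂ) * a y *
                iteratedDeriv k (fun z => χ (ε * z)) y) x) ∧
    (∀ φ : ℝ → ℂ, IsCutoff φ → ∀ l : ℕ, 1 ≤ l →
      IntegrableOn
        (fun x : ℝ => Complex.exp (s * Complex.I * lam * ((x ^ p : ℝ) : ℂ)) *
          (((x ^ (q - 1) : ℝ) : ℂ) * a x * (1 - φ x) *
            iteratedDeriv k (fun z => χ (ε * z)) x))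
        (Set.Ioi 0) ∧
      IntegrableOn
        (fun x : ℝ => Complex.exp (s * Complex.I * lam * ((x ^ p : ℝ) : ℂ)) *
          (fun g => fun y => (s : ℂ) * Lstar lam p g y)^[l]
            (fun y => ((y ^ (q - 1) : ℝ) : ℂ) * a y * (1 - φ y) *
              iteratedDeriv k (fun z => χ (ε * z)) y) x)
        (Set.Ioi 0) ∧
      (∫ x in Set.Ioi (0 : ℝ),
          Complex.exp (s * Complex.I * lam * ((x ^ p : ℝ) : ℂ)) *
            (((x ^ (q - 1) : ℝ) : ℂ) * a x * (1 - φ x) *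
              iteratedDeriv k (fun z => χ (ε * z)) x)) =
        ∫ x in Set.Ioi (0 : ℝ),
          Complex.exp (s * Complex.I * lam * ((x ^ p : ℝ) : ℂ)) *
            (fun g => fun y => (s : ℂ) * Lstar lam p g y)^[l]
              (fun y => ((y ^ (q - 1) : ℝ) : ℂ) * a y * (1 - φ y) *
                iteratedDeriv k (fun z => χ (ε * z)) y) x) := by
  obtain ⟨X, hX⟩ := exists_schwartzMap_iteratedDeriv_comp_mul χ hε₀.ne' k
  have haX : ∀ x, SchwartzMap.smulLeftCLM ℂ a X x = a x * X x := fun x => by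
    rw [SchwartzMap.smulLeftCLM_apply_apply ha.hasTemperateGrowth, smul_eq_mul]
  refine ⟨fun _ l _ hl => ?_, fun φ hφ l _ => ?_⟩
  · have hlq : (l : ℝ) * p < q := by
      have : (l : ℤ) < ⌈q / p⌉ := by omega
      rw [Int.lt_ceil, Int.cast_natCast] at this
      exact (lt_div_iff₀ hp).1 this
    have hg : EqOn (fun y : ℝ => ((y ^ (q - 1) : ℝ) : ℂ) * a y *
          iteratedDeriv k (fun z => χ (ε * z)) y)
        (fun y : ℝ => ((y ^ (q - 1) : ℝ) : ℂ) * SchwartzMap.smulLeftCLM ℂ a X y) (Ioi 0) :=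
      fun x _ => by simp only [haX, hX, mul_assoc]
    refine ⟨?_, integral_exp_mul_iterate_Lstar hlam hp hs l hg (Or.inl (by linarith))⟩
    exact (integral_exp_mul_iterate_Lstar hlam hp hs 0 hg (Or.inl (by simpa using hq))).1
  · have hφ' : (fun x => 1 - φ x).HasTemperateGrowth :=
      (Function.HasTemperateGrowth.const 1).sub hφ.hasTemperateGrowth
    set Y := SchwartzMap.smulLeftCLM ℂ (fun x => 1 - φ x) (SchwartzMap.smulLeftCLM ℂ a X)
    have hY : ∀ x, Y x = (1 - φ x) * (a x * X x) := fun x => by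
      rw [SchwartzMap.smulLeftCLM_apply_apply hφ', haX, smul_eq_mul]
    have hY₀ : Y =ᶠ[𝓝 0] 0 := by
      obtain ⟨-, r₀, -, hr₀, -, h₁, -⟩ := hφ
      filter_upwards [Metric.closedBall_mem_nhds (0 : ℝ) one_pos] with x hx
      rw [mem_closedBall_zero_iff, Real.norm_eq_abs] at hx
      simp [hY, h₁ x (hx.trans hr₀)]
    have hg : EqOn (fun y : ℝ => ((y ^ (q - 1) : ℝ) : ℂ) * a y * (1 - φ y) *
          iteratedDeriv k (fun z => χ (ε * z)) y)
        (fun y : ℝ => ((y ^ (q - 1) : ℝ) : ℂ) * Y y) (Ioi 0) :=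
      fun x _ => by simp only [hY, hX]; ring
    refine ⟨?_, integral_exp_mul_iterate_Lstar hlam hp hs l hg (Or.inr hY₀)⟩
    exact (integral_exp_mul_iterate_Lstar hlam hp hs 0 hg (Or.inr hY₀)).1
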